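/- arXiv:2102.11429 — 6 statements merged into one kernel-verified Lean document; each statement's English description precedes it below -/
import Mathlib

section
/- Let S be a nonempty finite set, let C ⊆ Δ(S) be a convex set of priors, and let A ⊆ S satisfy π(A) > 0 for every π ∈ C. Then for every ρ ∈ [0,1] the PB posterior set C^ρ_A is a convex subset of Δ(S). -/
open Finset

noncomputable section

/-- The set of priors (probability distributions) on a finite state space `S`. -/
def simplex (S : Type*) [Fintype S] : Set (S → ℝ) :=
  {π | (∀ s, 0 ≤ π s) ∧ ∑ s, π s = 1}

variable {S : Type*} [Fintype S] [DecidableEq S]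

/-- The probability of an event `A` under the prior `π`: `π(A) = ∑_{s ∈ A} π s`. -/
def pr (π : S → ℝ) (A : Finset S) : ℝ := ∑ s ∈ A, π s

/-- The Bayesian update `π_A` of a prior `π` given event `A`. -/
def bayes (π : S → ℝ) (A : Finset S) : S → ℝ :=
  fun s => if s ∈ A then π s / pr π A else 0

/-- Full bayesian posterior set: prior-by-prior Bayesian updating. -/
def BU (C : Set (S → ℝ)) (A : Finset S) : Set (S → ℝ) :=
  (fun π => bayes π A) '' C

/-- `sup_{μ ∈ C} μ(A)`. -/
def maxPr (C : Set (S → ℝ)) (A : Finset S) : ℝ :=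
  sSup ((fun μ => pr μ A) '' C)

/-- Partial bayesian posterior set with inference threshold `ρ`:
Bayesian updates of the priors `π ∈ C` with `π(A) ≥ ρ · sup_{μ ∈ C} μ(A)`. -/
def PB (C : Set (S → ℝ)) (A : Finset S) (ρ : ℝ) : Set (S → ℝ) :=
  (fun π => bayes π A) '' {π ∈ C | ρ * maxPr C A ≤ pr π A}

/-- Expected value of `a : S → ℝ` under the prior `ν`. -/
def expv (a : S → ℝ) (ν : S → ℝ) : ℝ := ∑ s, a s * ν s

/-- The probability of an event is affine in the prior. -/
theorem pr_combo {T : Type*} (π σ : T → ℝ) (A : Finset T) (t u : ℝ) :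
    pr (t • π + u • σ) A = t * pr π A + u * pr σ A := by
  simp [pr, Finset.sum_add_distrib, Finset.mul_sum]

/-- The Bayesian update of a prior given an event of positive probability is a prior. -/
theorem bayes_mem_simplex {π : S → ℝ} {A : Finset S} (hπ : ∀ s, 0 ≤ π s) (hA : 0 < pr π A) :
    bayes π A ∈ simplex S := by
  refine ⟨fun s => ?_, ?_⟩
  · unfold bayes
    split_ifs
    · exact div_nonneg (hπ s) hA.le
    · exact le_rfl
  · simp only [bayes, Finset.sum_ite_mem, Finset.univ_inter, ← Finset.sum_div]
    exact div_self hA.ne'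

/-- A convex combination of Bayesian updates is the Bayesian update of a convex combination
of the priors, with weights rescaled by the probabilities of the event. -/
theorem exists_bayes_combo {T : Type*} [DecidableEq T] {π σ : T → ℝ} {A : Finset T}
    (hπ : 0 < pr π A) (hσ : 0 < pr σ A)
    {a b : ℝ} (ha : 0 ≤ a) (hb : 0 ≤ b) (hab : a + b = 1) :
    ∃ t u : ℝ, 0 ≤ t ∧ 0 ≤ u ∧ t + u = 1 ∧
      bayes (t • π + u • σ) A = a • bayes π A + b • bayes σ A := by
  set p := pr π A with hp
  set q := pr σ A with hq
  have hk : 0 < a * q + b * p := by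
    rcases ha.eq_or_lt with rfl | ha
    · obtain rfl : b = 1 := by linarith
      simpa using hπ
    · positivity
  refine ⟨a * q / (a * q + b * p), b * p / (a * q + b * p), by positivity, by positivity, ?_, ?_⟩
  · rw [← add_div, div_self hk.ne']
  · have hpr : pr ((a * q / (a * q + b * p)) • π + (b * p / (a * q + b * p)) • σ) A
        = p * q / (a * q + b * p) := by
      rw [pr_combo, ← hp, ← hq, div_mul_eq_mul_div, div_mul_eq_mul_div, ← add_div]
      congr 1
      linear_combination p * q * hab
    funext s
    simp only [bayes, hpr, Pi.add_apply, Pi.smul_apply, smul_eq_mul, ← hp, ← hq]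
    split_ifs
    · field_simp
    · simp

theorem stmt2 {S : Type*} [Fintype S] [DecidableEq S] [Nonempty S]
    (C : Set (S → ℝ)) (hCsub : C ⊆ simplex S) (hCconv : Convex ℝ C)
    (A : Finset S) (hA : ∀ π ∈ C, 0 < pr π A)
    (ρ : ℝ) (hρ : ρ ∈ Set.Icc (0 : ℝ) 1) :
    Convex ℝ (PB C A ρ) ∧ PB C A ρ ⊆ simplex S := by
  refine ⟨?_, ?_⟩
  · rintro _ ⟨π, ⟨hπ, hπρ⟩, rfl⟩ _ ⟨σ, ⟨hσ, hσρ⟩, rfl⟩ a b ha hb hab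
    obtain ⟨t, u, ht, hu, htu, h⟩ := exists_bayes_combo (hA π hπ) (hA σ hσ) ha hb hab
    refine ⟨t • π + u • σ, ⟨hCconv hπ hσ ht hu htu, ?_⟩, h⟩
    rw [pr_combo]
    exact convex_Ici (𝕜 := ℝ) (ρ * maxPr C A) hπρ hσρ ht hu htu
  · rintro _ ⟨π, ⟨hπ, -⟩, rfl⟩
    exact bayes_mem_simplex (hCsub hπ).1 (hA π hπ)
end
end

section
/- (Proposition 3, full bayesian updating satisfies informational path independence.) Let S be a nonempty finite set, let B ⊆ A ⊆ S, and let C ⊆ Δ(S) be a set of priors with π(B) > 0 for every π ∈ C. Then updating the full bayesian posterior set BU(C,A) by B yields the same set as updating C directly by B: BU(BU(C,A), B) = BU(C,B). -/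
open Finset

noncomputable section

variable {S : Type*} [Fintype S] [DecidableEq S]

theorem bayes_of_mem {S : Type*} [Fintype S] [DecidableEq S] (π : S → ℝ) {A : Finset S} {s : S}
    (hs : s ∈ A) : bayes π A s = π s / pr π A :=
  if_pos hs

theorem pr_bayes_of_subset {S : Type*} [Fintype S] [DecidableEq S] {A B : Finset S}
    (hBA : B ⊆ A) (π : S → ℝ) : pr (bayes π A) B = pr π B / pr π A := by
  calc ∑ s ∈ B, bayes π A s = ∑ s ∈ B, π s / pr π A :=
        Finset.sum_congr rfl fun s hs => bayes_of_mem π (hBA hs)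
    _ = pr π B / pr π A := (Finset.sum_div _ _ _).symm

theorem bayes_bayes_of_subset {S : Type*} [Fintype S] [DecidableEq S] {A B : Finset S}
    (hBA : B ⊆ A) {π : S → ℝ} (hA : pr π A ≠ 0) :
    bayes (bayes π A) B = bayes π B := by
  funext s
  by_cases hs : s ∈ B
  · rw [bayes_of_mem _ hs, bayes_of_mem _ hs, bayes_of_mem _ (hBA hs), pr_bayes_of_subset hBA,
      div_div_div_cancel_right₀ hA]
  · simp only [bayes, if_neg hs]

theorem stmt6 {S : Type*} [Fintype S] [DecidableEq S] [Nonempty S]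
    (A B : Finset S) (hBA : B ⊆ A)
    (C : Set (S → ℝ)) (hCsub : C ⊆ simplex S)
    (hB : ∀ π ∈ C, 0 < pr π B) :
    BU (BU C A) B = BU C B := by
  unfold BU
  rw [Set.image_image]
  refine Set.image_congr fun π hπ => bayes_bayes_of_subset hBA (ne_of_gt ?_)
  exact (hB π hπ).trans_le
    (Finset.sum_le_sum_of_subset_of_nonneg hBA fun s _ _ => (hCsub hπ).1 s)
end
end

section
/- (Proposition 4, PB violates informational path independence.) Let S be a nonempty finite set, let B ⊆ A ⊆ S with B ≠ A and |B| ≥ 2, and let C ⊆ Δ(S) be a nonempty compact set of priors with π(B) > 0 for every π ∈ C. Suppose there exist ρ_A ∈ [0,1], a prior π ∈ C, and states s, s' ∈ B such that for every μ ∈ C with μ(A) ≥ ρ_A · max_{μ̂∈C} μ̂(A) one has π(s)·μ(s') ≠ π(s')·μ(s). Set ρ̄ := π(B) / max_{μ̂∈C} μ̂(B) ∈ (0,1]. Then for every ρ_B ∈ [0, ρ̄]: π_B ∈ C^{ρ_B}_B but π_B ∉ (C^{ρ_A}_A)^{ρ_B}_B; in particular (C^{ρ_A}_A)^{ρ_B}_B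 ≠ C^{ρ_B}_B, so informational path independence fails at A and B. -/
open Finset

noncomputable section

variable {S : Type*} [Fintype S] [DecidableEq S]

/-- Bayesian updating first on `A` and then on `B ⊆ A` is Bayesian updating on `B`. -/
theorem bayes_bayes {S : Type*} [Fintype S] [DecidableEq S] {A B : Finset S} (hBA : B ⊆ A)
    {μ : S → ℝ} (hA : pr μ A ≠ 0) : bayes (bayes μ A) B = bayes μ B := by
  have hpr : pr (bayes μ A) B = pr μ B / pr μ A := by
    unfold pr
    rw [Finset.sum_div]
    exact Finset.sum_congr rfl fun x hx => by simp [bayes, hBA hx, pr]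
  funext x
  by_cases hx : x ∈ B
  · have h : bayes μ A x = μ x / pr μ A := by simp [bayes, hBA hx]
    simp only [bayes.eq_def _ B, hx, if_true, hpr, h]
    exact div_div_div_cancel_right₀ hA _ _
  · simp [bayes, hx]

/-- Priors with the same Bayesian update on `B` have the same odds ratios on `B`. -/
theorem mul_eq_mul_of_bayes_eq {S : Type*} [Fintype S] [DecidableEq S] {B : Finset S}
    {μ π : S → ℝ} (hμ : pr μ B ≠ 0) (hπ : pr π B ≠ 0) (h : bayes μ B = bayes π B)
    {s s' : S} (hs : s ∈ B) (hs' : s' ∈ B) : π s * μ s' = π s' * μ s := by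
  have h1 : μ s / pr μ B = π s / pr π B := by simpa [bayes, hs] using congrFun h s
  have h2 : μ s' / pr μ B = π s' / pr π B := by simpa [bayes, hs'] using congrFun h s'
  rw [div_eq_div_iff hμ hπ] at h1 h2
  apply mul_right_cancel₀ hπ
  linear_combination π s * h2 - π s' * h1

/-- On a compact set of priors, the probability of an event is at most its supremum. -/
theorem pr_le_maxPr {S : Type*} [Fintype S] [DecidableEq S] {C : Set (S → ℝ)}
    (hC : IsCompact C) (A : Finset S) {μ : S → ℝ} (hμ : μ ∈ C) : pr μ A ≤ maxPr C A := by
  have hcont : Continuous fun μ : S → ℝ => pr μ A := by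
    unfold pr
    fun_prop
  exact le_csSup (hC.image hcont).bddAbove ⟨μ, hμ, rfl⟩

theorem stmt7 {S : Type*} [Fintype S] [DecidableEq S] [Nonempty S]
    (A B : Finset S) (hBA : B ⊆ A) (hBneA : B ≠ A) (hBcard : 2 ≤ B.card)
    (C : Set (S → ℝ)) (hCsub : C ⊆ simplex S) (hCne : C.Nonempty) (hCcomp : IsCompact C)
    (hB : ∀ π ∈ C, 0 < pr π B)
    (ρA : ℝ) (hρA : ρA ∈ Set.Icc (0 : ℝ) 1)
    (π : S → ℝ) (hπ : π ∈ C) (s s' : S) (hs : s ∈ B) (hs' : s' ∈ B)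
    (hkey : ∀ μ ∈ C, ρA * maxPr C A ≤ pr μ A → π s * μ s' ≠ π s' * μ s)
    (ρbar : ℝ) (hρbar : ρbar = pr π B / maxPr C B) :
    0 < ρbar ∧ ρbar ≤ 1 ∧
      ∀ ρB ∈ Set.Icc (0 : ℝ) ρbar,
        bayes π B ∈ PB C B ρB ∧
        bayes π B ∉ PB (PB C A ρA) B ρB ∧
        PB (PB C A ρA) B ρB ≠ PB C B ρB := by
  have hle := pr_le_maxPr hCcomp B hπ
  have hpos := hB π hπ
  have hmax : 0 < maxPr C B := hpos.trans_le hle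
  subst hρbar
  refine ⟨div_pos hpos hmax, (div_le_one hmax).2 hle, fun ρB hρB => ?_⟩
  have hmem : bayes π B ∈ PB C B ρB := ⟨π, ⟨hπ, (le_div_iff₀ hmax).1 hρB.2⟩, rfl⟩
  have hnot : bayes π B ∉ PB (PB C A ρA) B ρB := by
    rintro ⟨_, ⟨⟨μ, ⟨hμ, hμA⟩, rfl⟩, -⟩, h⟩
    have hBle : pr μ B ≤ pr μ A :=
      Finset.sum_le_sum_of_subset_of_nonneg hBA fun x _ _ => (hCsub hμ).1 x
    have hA : pr μ A ≠ 0 := ((hB μ hμ).trans_le hBle).ne'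
    exact hkey μ hμ hμA (mul_eq_mul_of_bayes_eq (hB μ hμ).ne' hpos.ne'
      ((bayes_bayes hBA hA).symm.trans h) hs hs')
  exact ⟨hmem, hnot, fun h => hnot (h ▸ hmem)⟩
end
end

section
/- (Theorem 2, comparative inference and uncertainty aversion.) Let S be a nonempty finite set, let C ⊆ Δ(S) be a nonempty compact convex set of priors, and let A ⊆ S satisfy π(A) > 0 for every π ∈ C. Suppose ρ₁, ρ₂ ∈ [0,1] are minimal, i.e., ρᵢ = inf { ρ ∈ [0,1] : C^ρ_A = C^{ρᵢ}_A } for i = 1,2. Then the following are equivalent: (i) the conditional preference with posterior set C^{ρ₁}_A is less uncertainty averse than the one with C^{ρ₂}_A, i.e., for every a : S → ℝ and c ∈ ℝ, if c ≥ min over ν ∈ C^{ρ₁}_A of E_ν[a] then c ≥ min over ν ∈ C^{ρ₂}_A of E_ν[a]; (ii) ρ₁ ≥ ρ₂. -/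
open Finset

noncomputable section

variable {S : Type*} [Fintype S] [DecidableEq S]

omit [Fintype S] [DecidableEq S] in
theorem continuous_pr (A : Finset S) : Continuous fun π : S → ℝ => pr π A := by
  unfold pr
  fun_prop

omit [DecidableEq S] in
theorem continuous_expv (a : S → ℝ) : Continuous (expv a) := by
  unfold expv
  fun_prop

omit [Fintype S] [DecidableEq S] in
theorem pr_combo_s9 (x y : S → ℝ) (A : Finset S) (α β : ℝ) :
    pr (α • x + β • y) A = α * pr x A + β * pr y A := by
  simp [pr, Finset.sum_add_distrib, Finset.mul_sum]

omit [Fintype S] in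
theorem continuousOn_bayes {K : Set (S → ℝ)} {A : Finset S} (hA : ∀ π ∈ K, 0 < pr π A) :
    ContinuousOn (fun π => bayes π A) K := by
  refine continuousOn_pi.2 fun s => ?_
  by_cases hs : s ∈ A
  · simp only [bayes, hs, if_true]
    exact (continuous_apply s).continuousOn.div (continuous_pr A).continuousOn
      fun π hπ => (hA π hπ).ne'
  · simpa only [bayes, hs, if_false] using continuousOn_const

omit [Fintype S] in
theorem convex_bayes_image {K : Set (S → ℝ)} {A : Finset S} (hA : ∀ π ∈ K, 0 < pr π A)
    (hK : Convex ℝ K) : Convex ℝ ((fun π => bayes π A) '' K) := by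
  rintro _ ⟨x, hx, rfl⟩ _ ⟨y, hy, rfl⟩ t u ht hu htu
  have hp := hA x hx
  have hq := hA y hy
  have hD : 0 < t / pr x A + u / pr y A := by
    rcases ht.eq_or_lt with rfl | ht'
    · have : u = 1 := by linarith
      subst this
      positivity
    · positivity
  set D := t / pr x A + u / pr y A
  have hpr : pr ((t / pr x A / D) • x + (u / pr y A / D) • y) A = 1 / D := by
    rw [pr_combo_s9, ← htu]
    field_simp
  refine ⟨(t / pr x A / D) • x + (u / pr y A / D) • y, hK hx hy (by positivity)
    (by positivity) (by rw [← add_div, div_self hD.ne']), ?_⟩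
  funext s
  by_cases hs : s ∈ A
  · simp only [bayes, hs, if_true, hpr, Pi.add_apply, Pi.smul_apply, smul_eq_mul]
    field_simp
  · simp [bayes, hs]

omit [Fintype S] in
theorem isCompact_PB {C : Set (S → ℝ)} (hC : IsCompact C) {A : Finset S}
    (hA : ∀ π ∈ C, 0 < pr π A) (ρ : ℝ) : IsCompact (PB C A ρ) :=
  (hC.inter_right (isClosed_le continuous_const (continuous_pr A))).image_of_continuousOn
    (continuousOn_bayes fun π hπ => hA π hπ.1)

omit [Fintype S] in
theorem convex_PB {C : Set (S → ℝ)} (hC : Convex ℝ C) {A : Finset S}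
    (hA : ∀ π ∈ C, 0 < pr π A) (ρ : ℝ) : Convex ℝ (PB C A ρ) := by
  refine convex_bayes_image (fun π hπ => hA π hπ.1) ?_
  rintro x ⟨hx, hx'⟩ y ⟨hy, hy'⟩ t u ht hu htu
  refine ⟨hC hx hy ht hu htu, ?_⟩
  rw [pr_combo_s9]
  calc ρ * maxPr C A = t * (ρ * maxPr C A) + u * (ρ * maxPr C A) := by
        rw [← add_mul, htu, one_mul]
    _ ≤ t * pr x A + u * pr y A := by gcongr

omit [Fintype S] in
theorem PB_nonempty {C : Set (S → ℝ)} (hC : IsCompact C) (hne : C.Nonempty) {A : Finset S}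
    (hA : ∀ π ∈ C, 0 < pr π A) {ρ : ℝ} (hρ : ρ ≤ 1) : (PB C A ρ).Nonempty := by
  obtain ⟨π, hπ, hmax⟩ := hC.exists_sSup_image_eq hne (continuous_pr A).continuousOn
  have hmax' : maxPr C A = pr π A := hmax
  exact ⟨_, π, ⟨hπ, hmax'.symm ▸ mul_le_of_le_one_left (hA π hπ).le hρ⟩, rfl⟩

omit [Fintype S] in
theorem PB_anti {C : Set (S → ℝ)} {A : Finset S}
    (hA : ∀ π ∈ C, 0 < pr π A) {ρ ρ' : ℝ} (h : ρ ≤ ρ') : PB C A ρ' ⊆ PB C A ρ := by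
  have hM : 0 ≤ maxPr C A := Real.sSup_nonneg <| by
    rintro _ ⟨π, hπ, rfl⟩
    exact (hA π hπ).le
  rintro _ ⟨π, ⟨hπ, hle⟩, rfl⟩
  exact ⟨π, ⟨hπ, (mul_le_mul_of_nonneg_right h hM).trans hle⟩, rfl⟩

theorem eq_expv (f : (S → ℝ) →L[ℝ] ℝ) (ν : S → ℝ) :
    f ν = expv (fun s => f (Pi.single s 1)) ν := by
  conv_lhs => rw [← Finset.univ_sum_single ν, map_sum]
  refine Finset.sum_congr rfl fun s _ => ?_
  have : (Pi.single s (ν s) : S → ℝ) = ν s • Pi.single s 1 := by simp [← Pi.single_smul]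
  rw [this, map_smul, smul_eq_mul, mul_comm]

/-- Comparing minimal expected values over compact convex sets amounts to inclusion. -/
theorem subset_iff_sInf_expv_le {P Q : Set (S → ℝ)} (hP : IsCompact P) (hPne : P.Nonempty)
    (hQ : IsCompact Q) (hQne : Q.Nonempty) (hQc : Convex ℝ Q) :
    (∀ (a : S → ℝ) (c : ℝ), sInf (expv a '' P) ≤ c → sInf (expv a '' Q) ≤ c) ↔ P ⊆ Q := by
  constructor
  · intro h ν hν
    by_contra hνQ
    obtain ⟨f, u, hfν, hfQ⟩ := geometric_hahn_banach_point_closed hQc hQ.isClosed hνQ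
    set a : S → ℝ := fun s => f (Pi.single s 1)
    have hP' : sInf (expv a '' P) ≤ f ν := by
      rw [eq_expv]
      exact csInf_le (hP.image (continuous_expv a)).bddBelow ⟨ν, hν, rfl⟩
    have hQ' : u ≤ sInf (expv a '' Q) := by
      refine le_csInf (hQne.image _) ?_
      rintro _ ⟨b, hb, rfl⟩
      exact (eq_expv f b ▸ hfQ b hb).le
    exact absurd (h a _ hP') (hfν.trans_le hQ').not_ge
  · intro h a c hc
    exact (csInf_le_csInf (hQ.image (continuous_expv a)).bddBelow (hPne.image _)
      (Set.image_mono h)).trans hc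

theorem stmt9 {S : Type*} [Fintype S] [DecidableEq S] [Nonempty S]
    (C : Set (S → ℝ)) (hCsub : C ⊆ simplex S) (hCne : C.Nonempty) (hCcomp : IsCompact C)
    (hCconv : Convex ℝ C)
    (A : Finset S) (hA : ∀ π ∈ C, 0 < pr π A)
    (ρ₁ ρ₂ : ℝ) (hρ₁ : ρ₁ ∈ Set.Icc (0 : ℝ) 1) (hρ₂ : ρ₂ ∈ Set.Icc (0 : ℝ) 1)
    (hmin₁ : ρ₁ = sInf {ρ | ρ ∈ Set.Icc (0 : ℝ) 1 ∧ PB C A ρ = PB C A ρ₁})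
    (hmin₂ : ρ₂ = sInf {ρ | ρ ∈ Set.Icc (0 : ℝ) 1 ∧ PB C A ρ = PB C A ρ₂}) :
    (∀ (a : S → ℝ) (c : ℝ),
        sInf (expv a '' PB C A ρ₁) ≤ c → sInf (expv a '' PB C A ρ₂) ≤ c)
      ↔ ρ₂ ≤ ρ₁ := by
  rw [subset_iff_sInf_expv_le (isCompact_PB hCcomp hA ρ₁) (PB_nonempty hCcomp hCne hA hρ₁.2)
    (isCompact_PB hCcomp hA ρ₂) (PB_nonempty hCcomp hCne hA hρ₂.2) (convex_PB hCconv hA ρ₂)]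
  refine ⟨fun h => ?_, PB_anti hA⟩
  rcases le_total ρ₂ ρ₁ with h' | h'
  · exact h'
  · rw [hmin₂]
    exact csInf_le ⟨0, fun ρ hρ => hρ.1.1⟩ ⟨hρ₁, h.antisymm (PB_anti hA h')⟩
end
end

section
/- (PB can produce strict rankings where both FB and ML are indifferent.) There exist a nonempty finite set S, a nonempty compact convex set of priors C ⊆ Δ(S), a set A ⊆ S with π(A) > 0 for every π ∈ C, a threshold ρ ∈ (0,1), and functions a, b : S → ℝ such that: min over ν ∈ BU(C,A) of E_ν[a] = min over ν ∈ BU(C,A) of E_ν[b]; min over ν ∈ C^1_A of E_ν[a] = min over ν ∈ C^1_A of E_ν[b]; but min over ν ∈ C^ρ_A of E_ν[b] > min over ν ∈ C^ρ_A of E_ν[a]. -/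
open Finset

noncomputable section

variable {S : Type*} [Fintype S] [DecidableEq S]

/-- The triangle of priors on three states with vertices `(0, 1/2, 1/2)`, `(1/4, 0, 3/4)` and
`(1/2, 1/2, 0)`. -/
def priorTriangle : Set (Fin 3 → ℝ) :=
  {π | π ∈ simplex (Fin 3) ∧ π 1 ≤ 1 / 2 ∧ 2 * π 0 - 1 / 2 ≤ π 1 ∧ 1 / 2 - 2 * π 0 ≤ π 1}

theorem mem_priorTriangle {π : Fin 3 → ℝ} :
    π ∈ priorTriangle ↔ (0 ≤ π 0 ∧ 0 ≤ π 1 ∧ 0 ≤ π 2) ∧ π 0 + π 1 + π 2 = 1 ∧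
      π 1 ≤ 1 / 2 ∧ 2 * π 0 - 1 / 2 ≤ π 1 ∧ 1 / 2 - 2 * π 0 ≤ π 1 := by
  simp [priorTriangle, simplex, Fin.forall_fin_succ, Fin.sum_univ_three, and_assoc]

theorem isCompact_priorTriangle : IsCompact priorTriangle := by
  refine (isCompact_stdSimplex ℝ (Fin 3)).inter_right
    (t := {π | π 1 ≤ 1 / 2 ∧ 2 * π 0 - 1 / 2 ≤ π 1 ∧ 1 / 2 - 2 * π 0 ≤ π 1}) ?_
  have h₁ : IsClosed {π : Fin 3 → ℝ | π 1 ≤ 1 / 2} :=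
    isClosed_le (by fun_prop) (by fun_prop)
  have h₂ : IsClosed {π : Fin 3 → ℝ | 2 * π 0 - 1 / 2 ≤ π 1} :=
    isClosed_le (by fun_prop) (by fun_prop)
  have h₃ : IsClosed {π : Fin 3 → ℝ | 1 / 2 - 2 * π 0 ≤ π 1} :=
    isClosed_le (by fun_prop) (by fun_prop)
  exact h₁.inter (h₂.inter h₃)

theorem convex_priorTriangle : Convex ℝ priorTriangle := by
  refine (convex_stdSimplex ℝ (Fin 3)).inter
    (t := {π | π 1 ≤ 1 / 2 ∧ 2 * π 0 - 1 / 2 ≤ π 1 ∧ 1 / 2 - 2 * π 0 ≤ π 1}) ?_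
  rintro x ⟨hx₁, hx₂, hx₃⟩ y ⟨hy₁, hy₂, hy₃⟩ s t hs ht hst
  simp only [Set.mem_ofPred_eq, Pi.add_apply, Pi.smul_apply, smul_eq_mul]
  refine ⟨?_, ?_, ?_⟩ <;> nlinarith

theorem pr_zero_one (π : Fin 3 → ℝ) : pr π {0, 1} = π 0 + π 1 := by
  simp [pr]

theorem expv_bayes_zero (π : Fin 3 → ℝ) :
    expv ![1, 0, 0] (bayes π {0, 1}) = π 0 / (π 0 + π 1) := by
  simp [expv, bayes, pr_zero_one, Fin.sum_univ_three]

theorem expv_bayes_one (π : Fin 3 → ℝ) :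
    expv ![0, 1, 0] (bayes π {0, 1}) = π 1 / (π 0 + π 1) := by
  simp [expv, bayes, pr_zero_one, Fin.sum_univ_three]

theorem left_mem_priorTriangle : ![0, 1 / 2, 1 / 2] ∈ priorTriangle := by
  rw [mem_priorTriangle]; simp; norm_num

theorem bottom_mem_priorTriangle : ![1 / 4, 0, 3 / 4] ∈ priorTriangle := by
  rw [mem_priorTriangle]; simp; norm_num

theorem right_mem_priorTriangle : ![1 / 2, 1 / 2, 0] ∈ priorTriangle := by
  rw [mem_priorTriangle]; simp; norm_num

theorem pr_pos_of_mem_priorTriangle {π : Fin 3 → ℝ} (h : π ∈ priorTriangle) :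
    0 < π 0 + π 1 := by
  rw [mem_priorTriangle] at h; linarith

theorem maxPr_priorTriangle : maxPr priorTriangle {0, 1} = 1 := by
  refine IsGreatest.csSup_eq ⟨⟨_, right_mem_priorTriangle, ?_⟩, ?_⟩
  · simp [pr_zero_one]; norm_num
  · rintro _ ⟨π, hπ, rfl⟩
    rw [mem_priorTriangle] at hπ
    simp only [pr_zero_one]
    linarith

theorem BU_eq_PB_zero {T : Type*} [DecidableEq T] (C : Set (T → ℝ)) (A : Finset T)
    (hC : ∀ π ∈ C, 0 ≤ pr π A) :
    BU C A = PB C A 0 := by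
  unfold BU PB
  congr 1
  ext π
  simpa using hC π

/-- If `c` is a lower bound, attained at `π₀`, for the posterior expectation of `f` over the priors
in the triangle that pass the likelihood threshold `ρ`, then it is the minimal one. -/
theorem sInf_expv_PB_priorTriangle {f : Fin 3 → ℝ} {ρ c : ℝ} {π₀ : Fin 3 → ℝ}
    (h₀ : π₀ ∈ priorTriangle) (hρ : ρ ≤ π₀ 0 + π₀ 1) (hc : expv f (bayes π₀ {0, 1}) = c)
    (h : ∀ π ∈ priorTriangle, ρ ≤ π 0 + π 1 → c ≤ expv f (bayes π {0, 1})) :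
    sInf (expv f '' PB priorTriangle {0, 1} ρ) = c := by
  refine IsLeast.csInf_eq ⟨⟨_, ⟨π₀, ⟨h₀, ?_⟩, rfl⟩, hc⟩, ?_⟩
  · rwa [maxPr_priorTriangle, mul_one, pr_zero_one]
  · rintro _ ⟨_, ⟨π, ⟨hπ, hπρ⟩, rfl⟩, rfl⟩
    rw [maxPr_priorTriangle, mul_one, pr_zero_one] at hπρ
    exact h π hπ hπρ

theorem stmt14 :
    ∃ (S : Type) (_ : Fintype S) (_ : DecidableEq S) (_ : Nonempty S)
      (C : Set (S → ℝ)) (A : Finset S) (ρ : ℝ) (a b : S → ℝ),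
      C ⊆ simplex S ∧ C.Nonempty ∧ IsCompact C ∧ Convex ℝ C ∧
      (∀ π ∈ C, 0 < pr π A) ∧ ρ ∈ Set.Ioo (0 : ℝ) 1 ∧
      sInf (expv a '' BU C A) = sInf (expv b '' BU C A) ∧
      sInf (expv a '' PB C A 1) = sInf (expv b '' PB C A 1) ∧
      sInf (expv a '' PB C A ρ) < sInf (expv b '' PB C A ρ) := by
  refine ⟨Fin 3, inferInstance, inferInstance, inferInstance, priorTriangle, {0, 1}, 1 / 2,
    ![1, 0, 0], ![0, 1, 0], fun _ h => h.1, ⟨_, left_mem_priorTriangle⟩,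
    isCompact_priorTriangle, convex_priorTriangle, ?_, by norm_num, ?_, ?_, ?_⟩
  · intro π hπ
    rw [pr_zero_one]
    exact pr_pos_of_mem_priorTriangle hπ
  · rw [BU_eq_PB_zero _ _ fun π hπ => by
        rw [pr_zero_one]; exact (pr_pos_of_mem_priorTriangle hπ).le,
      sInf_expv_PB_priorTriangle (c := 0) left_mem_priorTriangle,
      sInf_expv_PB_priorTriangle (c := 0) bottom_mem_priorTriangle]
    any_goals simp [expv_bayes_zero, expv_bayes_one]
    all_goals
      intro π hπ _
      have := pr_pos_of_mem_priorTriangle hπ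
      rw [mem_priorTriangle] at hπ
      exact div_nonneg (by linarith) this.le
  · rw [sInf_expv_PB_priorTriangle (c := 1 / 2) right_mem_priorTriangle,
      sInf_expv_PB_priorTriangle (c := 1 / 2) right_mem_priorTriangle]
    any_goals norm_num [expv_bayes_zero, expv_bayes_one]
    all_goals
      intro π hπ hπ₁
      have := pr_pos_of_mem_priorTriangle hπ
      rw [mem_priorTriangle] at hπ
      rw [le_div_iff₀ this]
      linarith
  · rw [sInf_expv_PB_priorTriangle (c := 0) left_mem_priorTriangle,
      sInf_expv_PB_priorTriangle (c := 1 / 3) (π₀ := ![1 / 3, 1 / 6, 1 / 2])]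
    any_goals norm_num [expv_bayes_zero, expv_bayes_one]
    · rw [mem_priorTriangle]; simp; norm_num
    · intro π hπ _
      have := pr_pos_of_mem_priorTriangle hπ
      rw [mem_priorTriangle] at hπ
      rw [le_div_iff₀ this]
      linarith
    · intro π hπ _
      have := pr_pos_of_mem_priorTriangle hπ
      rw [mem_priorTriangle] at hπ
      exact div_nonneg hπ.1.1 this.le
end
end

section
/- (Maximum likelihood updating exhibits a primacy effect.) There exist a nonempty finite set S, sets B ⊆ A ⊆ S with B ≠ A, and a nonempty compact convex set of priors C ⊆ Δ(S) with π(B) > 0 for every π ∈ C, such that iterated maximum likelihood updating violates informational path independence: (C^1_A)^1_B ≠ C^1_B, where the superscript 1 denotes the PB posterior set with threshold ρ = 1. -/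
open Finset

noncomputable section

variable {S : Type*} [Fintype S] [DecidableEq S]

theorem PB_one_eq_singleton {C : Set (S → ℝ)} {A : Finset S} {p : S → ℝ} (hp : p ∈ C)
    (h : ∀ μ ∈ C, μ ≠ p → pr μ A < pr p A) : PB C A 1 = {bayes p A} := by
  have hle : ∀ μ ∈ C, pr μ A ≤ pr p A := by
    intro μ hμ
    by_cases hμp : μ = p
    · rw [hμp]
    · exact (h μ hμ hμp).le
  have hmax : maxPr C A = pr p A :=
    IsGreatest.csSup_eq ⟨⟨p, hp, rfl⟩, by rintro _ ⟨μ, hμ, rfl⟩; exact hle μ hμ⟩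
  have hset : {π ∈ C | 1 * maxPr C A ≤ pr π A} = {p} := by
    ext μ
    simp only [Set.mem_ofPred_eq, Set.mem_singleton_iff, one_mul, hmax]
    refine ⟨fun ⟨hμ, hge⟩ => ?_, by rintro rfl; exact ⟨hp, le_rfl⟩⟩
    by_contra hμp
    exact absurd (h μ hμ hμp) hge.not_gt
  rw [PB, hset, Set.image_singleton]

/-- The set of priors `(1/4, (1+t)/4, (1-t)/2, t/4)` with `t ∈ [0, 1]`. -/
def primacyPriors : Set (Fin 4 → ℝ) :=
  segment ℝ ![1/4, 1/4, 1/2, 0] ![1/4, 1/2, 0, 1/4]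

theorem exists_of_mem_primacyPriors {π : Fin 4 → ℝ} (hπ : π ∈ primacyPriors) :
    ∃ t : ℝ, 0 ≤ t ∧ t ≤ 1 ∧ π = ![1/4, (1 + t)/4, (1 - t)/2, t/4] := by
  obtain ⟨a, t, ha, ht, hat, rfl⟩ := hπ
  obtain rfl : a = 1 - t := by linarith
  refine ⟨t, ht, by linarith, ?_⟩
  ext i
  fin_cases i <;> simp <;> ring

theorem PB_primacyPriors_012 :
    PB primacyPriors {0, 1, 2} 1 = {bayes ![1/4, 1/4, 1/2, 0] {0, 1, 2}} := by
  refine PB_one_eq_singleton (left_mem_segment ℝ _ _) fun μ hμ hne => ?_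
  obtain ⟨t, ht0, ht1, rfl⟩ := exists_of_mem_primacyPriors hμ
  have ht : t ≠ 0 := by
    rintro rfl
    exact hne (by norm_num)
  have := ht0.lt_of_ne' ht
  simp [pr]
  linarith

theorem PB_primacyPriors_01 :
    PB primacyPriors {0, 1} 1 = {bayes ![1/4, 1/2, 0, 1/4] {0, 1}} := by
  refine PB_one_eq_singleton (right_mem_segment ℝ _ _) fun μ hμ hne => ?_
  obtain ⟨t, ht0, ht1, rfl⟩ := exists_of_mem_primacyPriors hμ
  have ht : t ≠ 1 := by
    rintro rfl
    exact hne (by norm_num)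
  have := ht1.lt_of_ne ht
  simp [pr]
  linarith

theorem stmt16 :
    ∃ (S : Type) (_ : Fintype S) (_ : DecidableEq S) (_ : Nonempty S)
      (A B : Finset S) (C : Set (S → ℝ)),
      B ⊆ A ∧ B ≠ A ∧
      C ⊆ simplex S ∧ C.Nonempty ∧ IsCompact C ∧ Convex ℝ C ∧
      (∀ π ∈ C, 0 < pr π B) ∧
      PB (PB C A 1) B 1 ≠ PB C B 1 := by
  refine ⟨Fin 4, inferInstance, inferInstance, inferInstance, {0, 1, 2}, {0, 1}, primacyPriors,
    by decide, by decide, fun π hπ => ?_, ⟨_, left_mem_segment ℝ _ _⟩, ?_, convex_segment _ _,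
    fun π hπ => ?_, ?_⟩
  · obtain ⟨t, ht0, ht1, rfl⟩ := exists_of_mem_primacyPriors hπ
    refine ⟨fun s => ?_, ?_⟩
    · fin_cases s <;> simp <;> linarith
    · simp [Fin.sum_univ_four]
      ring
  · rw [primacyPriors, ← convexHull_pair]
    exact (Set.toFinite _).isCompact_convexHull ℝ
  · obtain ⟨t, ht0, ht1, rfl⟩ := exists_of_mem_primacyPriors hπ
    simp [pr]
    linarith
  · rw [PB_primacyPriors_012, PB_primacyPriors_01,
      PB_one_eq_singleton (Set.mem_singleton _) (fun μ hμ hne => absurd hμ hne)]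
    intro h
    have h0 := congrFun (Set.singleton_injective h) 0
    have hA : ∑ x ∈ ({0, 1, 2} : Finset (Fin 4)), (![1/4, 1/4, 1/2, 0] : Fin 4 → ℝ) x = 1 := by
      simp
      norm_num
    norm_num [bayes, pr, hA] at h0
end
end
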